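/- Let d ≥ 1 and let F be a skew-symmetric endomorphism of Minkowski space 𝕄^{1,d-1}. Then at least one of the following holds: (i) there exists a nonzero null vector x with F x = λ x for some λ ∈ ℝ; (ii) there exists a non-null vector x with F x = 0; (iii) there exist vectors x, y with η(x,x) = η(y,y) > 0, η(x,y) = 0, and a real μ ≠ 0 such that F x = μ y and F y = -μ x. -/

import Mathlib

open scoped BigOperators

/-- The Minkowski bilinear form on `ℝ^d`. -/
noncomputable def mink (d : ℕ) (x y : Fin d → ℝ) : ℝ :=
  ∑ i : Fin d, (if (i : ℕ) = 0 then (-1 : ℝ) else 1) * x i * y i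

/-- Skew-symmetry w.r.t. the Minkowski form. -/
def IsSkew (d : ℕ) (F : (Fin d → ℝ) →ₗ[ℝ] (Fin d → ℝ)) : Prop :=
  ∀ x y, mink d (F x) y = - mink d x (F y)

theorem mink_comm (d : ℕ) (x y : Fin d → ℝ) : mink d x y = mink d y x :=
  Finset.sum_congr rfl fun _ _ => by ring

theorem mink_linearComb_left (d : ℕ) (a b : ℝ) (x y z : Fin d → ℝ) :
    mink d (a • x + b • y) z = a * mink d x z + b * mink d y z := by
  simp only [mink, Finset.mul_sum, ← Finset.sum_add_distrib, Pi.add_apply, Pi.smul_apply,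
    smul_eq_mul]
  exact Finset.sum_congr rfl fun _ _ => by ring

theorem mink_linearComb_right (d : ℕ) (a b : ℝ) (x y z : Fin d → ℝ) :
    mink d z (a • x + b • y) = a * mink d z x + b * mink d z y := by
  rw [mink_comm, mink_linearComb_left, mink_comm d x, mink_comm d y]

theorem mink_smul_left (d : ℕ) (a : ℝ) (x z : Fin d → ℝ) :
    mink d (a • x) z = a * mink d x z := by
  simpa using mink_linearComb_left d a 0 x 0 z

theorem IsSkew.mink_apply_self {d : ℕ} {F : (Fin d → ℝ) →ₗ[ℝ] (Fin d → ℝ)} (hF : IsSkew d F)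
    (x : Fin d → ℝ) : mink d (F x) x = 0 := by
  linarith [hF x x, mink_comm d (F x) x]

/-- The Minkowski form is positive definite on vectors with vanishing time component. -/
theorem eq_zero_of_mink_self_nonpos {n : ℕ} {x : Fin (n + 1) → ℝ} (h0 : x 0 = 0)
    (hx : mink (n + 1) x x ≤ 0) : x = 0 := by
  have hsum : mink (n + 1) x x = ∑ i : Fin n, x i.succ ^ 2 := by
    simp [mink, Fin.sum_univ_succ, h0, sq]
  have hzero := (Finset.sum_eq_zero_iff_of_nonneg fun (i : Fin n) _ => sq_nonneg (x i.succ)).1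
    (le_antisymm (hsum ▸ hx) (Finset.sum_nonneg fun i _ => sq_nonneg (x i.succ)))
  ext i
  refine Fin.cases h0 (fun j => ?_) i
  simpa using hzero j (Finset.mem_univ j)

/-- Orthogonal causal vectors are proportional. -/
theorem exists_eq_smul_of_mink_eq_zero {d : ℕ} (hd : 1 ≤ d) {x y : Fin d → ℝ} (hx0 : x ≠ 0)
    (hx : mink d x x ≤ 0) (hy : mink d y y ≤ 0) (hxy : mink d x y = 0) :
    ∃ t : ℝ, y = t • x := by
  obtain ⟨n, rfl⟩ := Nat.exists_eq_add_of_le' hd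
  have ht : x 0 ≠ 0 := fun h => hx0 (eq_zero_of_mink_self_nonpos h hx)
  have hz : x 0 • y + (-y 0) • x = 0 := by
    apply eq_zero_of_mink_self_nonpos
    · simp [mul_comm]
    · rw [mink_linearComb_left, mink_linearComb_right, mink_linearComb_right, mink_comm _ y x, hxy]
      nlinarith [mul_nonneg (sq_nonneg (x 0)) (neg_nonneg.2 hy),
        mul_nonneg (sq_nonneg (y 0)) (neg_nonneg.2 hx)]
  refine ⟨y 0 / x 0, ?_⟩
  ext i
  have hi := congrFun hz i
  simp only [Pi.add_apply, Pi.smul_apply, smul_eq_mul, Pi.zero_apply] at hi ⊢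
  field_simp
  linarith

/-- The real and imaginary parts of a complex eigenvector of a real endomorphism. -/
theorem exists_re_im_eigenvector {d : ℕ} (hd : 1 ≤ d) (F : (Fin d → ℝ) →ₗ[ℝ] (Fin d → ℝ)) :
    ∃ (x y : Fin d → ℝ) (a b : ℝ), (x ≠ 0 ∨ y ≠ 0) ∧
      F x = a • x + (-b) • y ∧ F y = b • x + a • y := by
  have : Nonempty (Fin d) := ⟨⟨0, hd⟩⟩
  set M := LinearMap.toMatrix' F with hM
  obtain ⟨c, hc⟩ := Module.End.exists_eigenvalue (Matrix.toLin' (M.map Complex.ofReal))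
  obtain ⟨v, hv⟩ := hc.exists_hasEigenvector
  have happ : ∀ w, F w = M.mulVec w := fun w => by
    rw [hM, LinearMap.toMatrix'_mulVec]
  have hvi : ∀ i, ∑ j, (M i j : ℂ) * v j = c * v i := fun i => by
    simpa [Matrix.mulVec, dotProduct] using congrFun hv.apply_eq_smul i
  refine ⟨fun i => (v i).re, fun i => (v i).im, c.re, c.im, ?_, ?_, ?_⟩
  · by_contra! h
    exact hv.2 (funext fun i => Complex.ext (congrFun h.1 i) (congrFun h.2 i))
  · ext i
    have := congrArg Complex.re (hvi i)
    simp only [Complex.re_sum, Complex.mul_re, Complex.ofReal_re, Complex.ofReal_im,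
      zero_mul, sub_zero] at this
    simp [happ, Matrix.mulVec, dotProduct, this, sub_eq_add_neg]
  · ext i
    have := congrArg Complex.im (hvi i)
    simp only [Complex.im_sum, Complex.mul_im, Complex.ofReal_re, Complex.ofReal_im,
      zero_mul, add_zero] at this
    simp [happ, Matrix.mulVec, dotProduct, this, add_comm]

/-- Every skew-symmetric endomorphism of Minkowski space has either a null
eigenvector, a non-null eigenvector with zero eigenvalue, or a spacelike
eigenplane with nonzero eigenvalue. -/
theorem stmt2 (d : ℕ) (hd : 1 ≤ d)
    (F : (Fin d → ℝ) →ₗ[ℝ] (Fin d → ℝ)) (hF : IsSkew d F) :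
    (∃ (x : Fin d → ℝ) (lam : ℝ), x ≠ 0 ∧ mink d x x = 0 ∧ F x = lam • x) ∨
    (∃ x : Fin d → ℝ, mink d x x ≠ 0 ∧ F x = 0) ∨
    (∃ (x y : Fin d → ℝ) (μ : ℝ), μ ≠ 0 ∧
      mink d x x = mink d y y ∧ 0 < mink d x x ∧ mink d x y = 0 ∧
      F x = μ • y ∧ F y = (-μ) • x) := by
  obtain ⟨x, y, a, b, hne, hFx, hFy⟩ := exists_re_im_eigenvector hd F
  have real_case : ∀ (w : Fin d → ℝ) (c : ℝ), w ≠ 0 → F w = c • w →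
      (∃ (x : Fin d → ℝ) (lam : ℝ), x ≠ 0 ∧ mink d x x = 0 ∧ F x = lam • x) ∨
      (∃ x : Fin d → ℝ, mink d x x ≠ 0 ∧ F x = 0) := by
    intro w c hw hFw
    by_cases hn : mink d w w = 0
    · exact Or.inl ⟨w, c, hw, hn, hFw⟩
    · have h := hF.mink_apply_self w
      rw [hFw, mink_smul_left] at h
      have hc : c = 0 := (mul_eq_zero.1 h).resolve_right hn
      exact Or.inr ⟨w, hn, by rw [hFw, hc, zero_smul]⟩
  rw [← or_assoc]
  by_cases hb : b = 0
  · subst hb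
    rcases hne with h | h
    · exact Or.inl (real_case x a h (by simpa using hFx))
    · exact Or.inl (real_case y a h (by simpa using hFy))
  have hx0 : x ≠ 0 := by
    rintro rfl
    have hy : b • y = 0 := by simpa using hFx.symm
    rcases hne with h | h
    · exact h rfl
    · exact (smul_ne_zero hb h) hy
  have h1 := hF.mink_apply_self x
  have h2 := hF.mink_apply_self y
  have h3 := hF x y
  rw [hFx, mink_linearComb_left, mink_comm d y x] at h1
  rw [hFy, mink_linearComb_left] at h2
  rw [hFx, hFy, mink_linearComb_left, mink_linearComb_right] at h3
  have key : mink d x y = 0 ∧ mink d x x = mink d y y := by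
    generalize mink d x x = A at *
    generalize mink d y y = B at *
    generalize mink d x y = C at *
    by_cases ha : a = 0
    · subst ha
      refine ⟨by simpa [hb] using h1, mul_left_cancel₀ hb (by linarith)⟩
    · have hB : B = -A := mul_left_cancel₀ ha (by linarith)
      subst hB
      have hA : (a ^ 2 + b ^ 2) * A = 0 := by linear_combination a * h1 + b / 2 * h3
      have hA0 : A = 0 := (mul_eq_zero.1 hA).resolve_left (by positivity)
      subst hA0
      exact ⟨by simpa [hb] using h1, by simp⟩
  obtain ⟨hxy, heq⟩ := key
  by_cases hpos : 0 < mink d x x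
  · have ha : a = 0 := by
      rw [hxy] at h1
      exact (mul_eq_zero.1 (by linarith : a * mink d x x = 0)).resolve_right hpos.ne'
    subst ha
    exact Or.inr ⟨x, y, -b, neg_ne_zero.2 hb, heq, hpos, hxy, by simpa using hFx,
      by simpa using hFy⟩
  · rw [not_lt] at hpos
    obtain ⟨t, rfl⟩ := exists_eq_smul_of_mink_eq_zero hd hx0 hpos (heq ▸ hpos) hxy
    exact Or.inl (real_case x (a + -b * t) hx0 (by rw [hFx, smul_smul, ← add_smul]))
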